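/- Let (A₁, A₂) be a commuting algebraic bipartition of a unital C*-algebra A and let Ω be a pure state on A. Then Ω is (A₁,A₂)-separable if and only if Ω(α₁α₂) = Ω(α₁)Ω(α₂) for all α₁ ∈ A₁ and α₂ ∈ A₂. -/

import Mathlib

open scoped ComplexOrder

/-- A state on a unital (C*-)algebra over ℂ. -/
def IsState {A : Type*} [Ring A] [StarRing A] [Algebra ℂ A]
    (Ω : A →ₗ[ℂ] ℂ) : Prop :=
  (∀ a : A, 0 ≤ Ω (star a * a)) ∧ Ω 1 = 1

/-- A pure state: a state admitting no nontrivial convex decomposition into states. -/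
def IsPureState {A : Type*} [Ring A] [StarRing A] [Algebra ℂ A]
    (Ω : A →ₗ[ℂ] ℂ) : Prop :=
  IsState Ω ∧
  ∀ (Ω₁ Ω₂ : A →ₗ[ℂ] ℂ) (t : ℝ), IsState Ω₁ → IsState Ω₂ → 0 < t → t < 1 →
    Ω = (t : ℂ) • Ω₁ + (((1 - t : ℝ)) : ℂ) • Ω₂ → Ω₁ = Ω ∧ Ω₂ = Ω

/-- A state `Ω` is `(A₁, A₂)`-separable if its expectation on every local operator
`α₁ * α₂` is a convex combination of products of expectations of states. -/
def IsSepState {A : Type*} [Ring A] [StarRing A] [Algebra ℂ A] [StarModule ℂ A]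
    (A₁ A₂ : StarSubalgebra ℂ A) (Ω : A →ₗ[ℂ] ℂ) : Prop :=
  ∃ (n : ℕ) (lam : Fin n → ℝ) (Ω₁ Ω₂ : Fin n → (A →ₗ[ℂ] ℂ)),
    (∀ k, 0 ≤ lam k) ∧ (∑ k, lam k) = 1 ∧
    (∀ k, IsState (Ω₁ k)) ∧ (∀ k, IsState (Ω₂ k)) ∧
    ∀ α₁ ∈ A₁, ∀ α₂ ∈ A₂,
      Ω (α₁ * α₂) = ∑ k, (lam k : ℂ) * Ω₁ k α₁ * Ω₂ k α₂

open scoped TensorProduct Matrix in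
/-- Expansion of positivity on `1 + c x`. -/
theorem IsState.expand_nonneg {T : Type*} [Ring T] [StarRing T] [Algebra ℂ T] [StarModule ℂ T]
    {φ : T →ₗ[ℂ] ℂ} (h : IsState φ) (x : T) (c : ℂ) :
    0 ≤ 1 + c * φ x + star c * φ (star x) + (star c * c) * φ (star x * x) := by
  have h1 := h.1 (1 + c • x)
  have h2 : star (1 + c • x) * (1 + c • x)
      = 1 + c • x + star c • star x + (star c * c) • (star x * x) := by
    rw [star_add, star_one, star_smul, add_mul, mul_add, mul_add, one_mul, one_mul, mul_one,
      smul_mul_smul_comm]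
    abel
  rw [h2] at h1
  simpa [h.2] using h1

theorem IsState.map_star' {T : Type*} [Ring T] [StarRing T] [Algebra ℂ T] [StarModule ℂ T]
    {φ : T →ₗ[ℂ] ℂ} (h : IsState φ) (x : T) : φ (star x) = star (φ x) := by
  have h0 := Complex.nonneg_iff.1 (h.1 x)
  have h1 := Complex.nonneg_iff.1 (h.expand_nonneg x 1)
  have h2 := Complex.nonneg_iff.1 (h.expand_nonneg x Complex.I)
  obtain ⟨-, h0⟩ := h0
  obtain ⟨-, h1⟩ := h1
  obtain ⟨-, h2⟩ := h2
  apply Complex.ext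
  · simp at *; linarith
  · simp at *; linarith

theorem IsState.eq_zero_of {T : Type*} [Ring T] [StarRing T] [Algebra ℂ T] [StarModule ℂ T]
    {φ : T →ₗ[ℂ] ℂ} (h : IsState φ) (x : T) (hx : φ (star x * x) = 0) : φ x = 0 := by
  have key := h.expand_nonneg x (-(star (φ x)) / (‖φ x‖ ^ 2 : ℝ))
  rw [hx, h.map_star'] at key
  by_contra hne
  have hn : (‖φ x‖ ^ 2 : ℝ) ≠ 0 := by simpa using hne
  have hn' : (((‖φ x‖ ^ 2 : ℝ)) : ℂ) ≠ 0 := by exact_mod_cast hn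
  have e : star (φ x) * φ x = ((‖φ x‖ ^ 2 : ℝ) : ℂ) := by
    have := Complex.conj_mul' (φ x)
    simpa using this
  have h1 : -(star (φ x)) / ((‖φ x‖ ^ 2 : ℝ) : ℂ) * φ x = -1 := by
    rw [div_mul_eq_mul_div, neg_mul, e, neg_div, div_self hn']
  have h2 : star (-(star (φ x)) / ((‖φ x‖ ^ 2 : ℝ) : ℂ)) * star (φ x) = -1 := by
    rw [← star_mul', h1]; simp
  rw [h1, h2] at key
  have := (Complex.nonneg_iff.1 key).1
  norm_num at this

/-- A state dominated by a multiple of a pure state pulled back along a surjective star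
homomorphism coincides with it. -/
theorem IsPureState.eq_of_le {T A : Type*} [Ring T] [StarRing T] [Algebra ℂ T] [StarModule ℂ T]
    [Ring A] [StarRing A] [Algebra ℂ A]
    {Ω : A →ₗ[ℂ] ℂ} (hΩ : IsPureState Ω) (m : T →ₐ[ℂ] A) (hstar : ∀ x, m (star x) = star (m x))
    (hm : Function.Surjective m) {φ : T →ₗ[ℂ] ℂ} (hφ : IsState φ) (t : ℝ) (ht : 0 < t)
    (ht1 : t < 1) (hle : ∀ x, (t : ℂ) * φ (star x * x) ≤ Ω (m (star x * x))) (x : T) :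
    Ω (m x) = φ x := by
  have htC : (0 : ℂ) < t := by exact_mod_cast ht
  have hker : LinearMap.ker m.toLinearMap ≤ LinearMap.ker φ := by
    intro y hy
    have hy' : m y = 0 := hy
    refine hφ.eq_zero_of y ?_
    have h1 := hle y
    rw [map_mul m, hy', mul_zero, map_zero] at h1
    have h2 := hφ.1 y
    have h3 : (t : ℂ) * φ (star y * y) = 0 := le_antisymm h1 (mul_nonneg htC.le h2)
    exact (mul_eq_zero.1 h3).resolve_left htC.ne'
  obtain ⟨ψ, hψ⟩ : ∃ ψ : A →ₗ[ℂ] ℂ, ψ.comp m.toLinearMap = φ := by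
    obtain ⟨s, hs⟩ := m.toLinearMap.exists_rightInverse_of_surjective
      (LinearMap.range_eq_top.2 hm)
    refine ⟨φ.comp s, LinearMap.ext fun y => ?_⟩
    have h1 : s (m y) - y ∈ LinearMap.ker m.toLinearMap := by
      have := LinearMap.congr_fun hs (m y)
      simp at this
      simp [this]
    have h2 := hker h1
    rw [LinearMap.mem_ker, map_sub, sub_eq_zero] at h2
    simpa using h2
  have hψ' : ∀ y, ψ (m y) = φ y := fun y => LinearMap.congr_fun hψ y
  have h1t : (0 : ℝ) < 1 - t := by linarith
  have h1tC : ((1 - t : ℝ) : ℂ) ≠ 0 := by exact_mod_cast h1t.ne'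
  have hψs : IsState ψ := by
    refine ⟨fun a => ?_, ?_⟩
    · obtain ⟨y, rfl⟩ := hm a
      rw [← hstar, ← map_mul, hψ']
      exact hφ.1 y
    · rw [← map_one m, hψ', hφ.2]
  have hρs : IsState (((1 - t : ℝ)⁻¹ : ℂ) • (Ω - (t : ℂ) • ψ)) := by
    refine ⟨fun a => ?_, ?_⟩
    · obtain ⟨y, rfl⟩ := hm a
      rw [← hstar, ← map_mul]
      have h := hle y
      rw [← hψ'] at h
      have h' : (0 : ℂ) ≤ ((1 - t : ℝ)⁻¹ : ℂ) := by
        exact_mod_cast (inv_pos.2 h1t).le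
      simp only [LinearMap.smul_apply, LinearMap.sub_apply, smul_eq_mul]
      exact mul_nonneg h' (sub_nonneg.2 h)
    · simp only [LinearMap.smul_apply, LinearMap.sub_apply, smul_eq_mul, hψs.2, hΩ.1.2]
      rw [mul_one, ← Complex.ofReal_one, ← Complex.ofReal_sub]
      exact inv_mul_cancel₀ h1tC
  have := (hΩ.2 ψ _ t hψs hρs ht ht1 (by
    rw [smul_smul, mul_inv_cancel₀ h1tC, one_smul]; abel)).1
  have hfin := hψ' x
  rw [this] at hfin
  exact hfin

/-- The Gram matrix of a state is positive semidefinite. -/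
theorem IsState.gram_posSemidef {T ι : Type*} [Ring T] [StarRing T] [Algebra ℂ T]
    [StarModule ℂ T] [Fintype ι] {φ : T →ₗ[ℂ] ℂ} (h : IsState φ) (a : ι → T) :
    (Matrix.of fun i j => φ (star (a i) * a j)).PosSemidef := by
  refine .of_dotProduct_mulVec_nonneg ?_ fun v => ?_
  · ext i j
    simp [Matrix.conjTranspose_apply, ← h.map_star']
  · have h1 := h.1 (∑ i, v i • a i)
    convert h1 using 1
    simp [dotProduct, Matrix.mulVec, star_sum, Finset.sum_mul, Finset.mul_sum, map_sum]
    try rw [Finset.sum_comm]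
    refine Finset.sum_congr rfl fun i _ => Finset.sum_congr rfl fun j _ => ?_
    ring

open scoped TensorProduct Matrix in
/-- The tensor product of two states is a state. -/
theorem IsState.tensor {S T : Type*} [Ring T] [StarRing T] [Algebra ℂ T]
    [StarModule ℂ T] [Ring S] [StarRing S] [Algebra ℂ S]
    [StarModule ℂ S] {φ : S →ₗ[ℂ] ℂ} {ψ : T →ₗ[ℂ] ℂ} (h : IsState φ) (h' : IsState ψ) :
    IsState ((LinearMap.mul' ℂ ℂ).comp (TensorProduct.map φ ψ)) := by
  refine ⟨fun x => ?_, ?_⟩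
  · obtain ⟨F, rfl⟩ := TensorProduct.exists_finset x
    have h1 := (h.gram_posSemidef (fun i : F => i.1.1)).hadamard
      (h'.gram_posSemidef (fun i : F => i.1.2))
    have h2 := h1.dotProduct_mulVec_nonneg (fun _ => 1)
    convert h2 using 1
    rw [← Finset.sum_coe_sort]
    simp [dotProduct, Matrix.mulVec, star_sum, Finset.sum_mul, Finset.mul_sum, map_sum,
      TensorProduct.star_tmul]
    try rw [Finset.sum_comm]
  · have e1 := h.2
    have e2 := h'.2
    simp [Algebra.TensorProduct.one_def, e1, e2]

/-- Restriction of a state to a star subalgebra. -/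
theorem IsState.restrict {T : Type*} [Ring T] [StarRing T] [Algebra ℂ T]
    [StarModule ℂ T] {φ : T →ₗ[ℂ] ℂ} (h : IsState φ) (S : StarSubalgebra ℂ T) :
    IsState (φ.comp S.subtype.toAlgHom.toLinearMap) :=
  ⟨fun a => by simpa using h.1 (a : T), by simpa using h.2⟩

open scoped TensorProduct in
/-- **Lemma 1**: for a commuting algebraic bipartition `(A₁, A₂)` of a unital
C*-algebra `A`, a pure state is `(A₁,A₂)`-separable iff it factorizes on all
local operators. -/
theorem pure_state_separable_iff_product
    {A : Type*} [NormedRing A] [StarRing A] [CStarRing A]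
    [NormedAlgebra ℂ A] [StarModule ℂ A] [CompleteSpace A]
    (A₁ A₂ : StarSubalgebra ℂ A)
    -- `(A₁, A₂)` is a commuting algebraic bipartition:
    (h_inter : ∀ x : A, x ∈ A₁ → x ∈ A₂ → ∃ c : ℂ, x = algebraMap ℂ A c)
    (h_comm : ∀ x ∈ A₁, ∀ y ∈ A₂, x * y = y * x)
    (h_gen : ∀ a : A, a ∈ Submodule.span ℂ {x : A | ∃ y ∈ A₁, ∃ z ∈ A₂, x = y * z})
    (Ω : A →ₗ[ℂ] ℂ) (hΩ : IsPureState Ω) :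
    IsSepState A₁ A₂ Ω ↔
      ∀ α₁ ∈ A₁, ∀ α₂ ∈ A₂, Ω (α₁ * α₂) = Ω α₁ * Ω α₂ := by
  constructor
  · rintro ⟨n, lam, Ω₁, Ω₂, hlam, hsum, hs₁, hs₂, hdec⟩
    obtain ⟨k, hk⟩ : ∃ k, 0 < lam k := by
      by_contra hcon
      push Not at hcon
      have : ∑ k, lam k ≤ 0 := Finset.sum_nonpos fun k _ => hcon k
      linarith
    have hk1 : lam k ≤ 1 := by
      rw [← hsum]
      exact Finset.single_le_sum (fun i _ => hlam i) (Finset.mem_univ k)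
    let m : A₁ ⊗[ℂ] A₂ →ₐ[ℂ] A := Algebra.TensorProduct.lift A₁.subtype.toAlgHom
      A₂.subtype.toAlgHom (fun x y => h_comm x x.2 y y.2)
    have hm_tmul : ∀ (x : A₁) (y : A₂), m (x ⊗ₜ y) = (x : A) * (y : A) := by
      intro x y
      exact Algebra.TensorProduct.lift_tmul _ _ _ x y
    have hstar : ∀ x, m (star x) = star (m x) := by
      intro x
      induction x with
      | zero => simp
      | add x y hx hy => rw [star_add, map_add, map_add, star_add, hx, hy]
      | tmul x y =>
        rw [TensorProduct.star_tmul, hm_tmul, hm_tmul, star_mul]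
        exact h_comm _ (star x).2 _ (star y).2
    have hsurj : Function.Surjective m := by
      intro a
      have hle : Submodule.span ℂ {x : A | ∃ y ∈ A₁, ∃ z ∈ A₂, x = y * z}
          ≤ LinearMap.range m.toLinearMap := by
        rw [Submodule.span_le]
        rintro _ ⟨y, hy, z, hz, rfl⟩
        exact ⟨(⟨y, hy⟩ : A₁) ⊗ₜ (⟨z, hz⟩ : A₂), hm_tmul _ _⟩
      exact hle (h_gen a)
    let Φ : Fin n → (A₁ ⊗[ℂ] A₂ →ₗ[ℂ] ℂ) := fun j =>
      (LinearMap.mul' ℂ ℂ).comp (TensorProduct.map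
        ((Ω₁ j).comp A₁.subtype.toAlgHom.toLinearMap)
        ((Ω₂ j).comp A₂.subtype.toAlgHom.toLinearMap))
    have hΦ : ∀ j, IsState (Φ j) := fun j => ((hs₁ j).restrict A₁).tensor ((hs₂ j).restrict A₂)
    have hΦ_tmul : ∀ j (x : A₁) (y : A₂), Φ j (x ⊗ₜ y) = Ω₁ j x * Ω₂ j y := by
      intro j x y
      simp [Φ]
    have hdecT : ∀ x, Ω (m x) = ∑ j, (lam j : ℂ) * Φ j x := by
      intro x
      induction x with
      | zero => simp
      | add x y hx hy =>
        rw [map_add, map_add, hx, hy, ← Finset.sum_add_distrib]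
        exact Finset.sum_congr rfl fun j _ => by rw [map_add, mul_add]
      | tmul x y =>
        rw [hm_tmul, hdec _ x.2 _ y.2]
        exact Finset.sum_congr rfl fun j _ => by rw [hΦ_tmul, mul_assoc]
    have hlamC : ∀ j, (0 : ℂ) ≤ lam j := fun j => by exact_mod_cast hlam j
    have key := hΩ.eq_of_le m hstar hsurj (hΦ k) (lam k / 2) (by linarith) (by linarith) (by
      intro x
      rw [hdecT]
      have h1 : (lam k : ℂ) * Φ k (star x * x) ≤ ∑ j, (lam j : ℂ) * Φ j (star x * x) :=
        Finset.single_le_sum (f := fun j => (lam j : ℂ) * Φ j (star x * x))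
          (fun j _ => mul_nonneg (hlamC j) ((hΦ j).1 x)) (Finset.mem_univ k)
      refine le_trans ?_ h1
      refine mul_le_mul_of_nonneg_right ?_ ((hΦ k).1 x)
      have : lam k / 2 ≤ lam k := by linarith
      exact_mod_cast this)
    have key' : ∀ α₁ ∈ A₁, ∀ α₂ ∈ A₂, Ω (α₁ * α₂) = Ω₁ k α₁ * Ω₂ k α₂ := by
      intro α₁ h₁ α₂ h₂
      have := key ((⟨α₁, h₁⟩ : A₁) ⊗ₜ (⟨α₂, h₂⟩ : A₂))
      rwa [hm_tmul, hΦ_tmul] at this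
    intro α₁ h₁ α₂ h₂
    have e1 := key' α₁ h₁ 1 (one_mem _)
    have e2 := key' 1 (one_mem _) α₂ h₂
    rw [mul_one, (hs₂ k).2, mul_one] at e1
    rw [one_mul, (hs₁ k).2, one_mul] at e2
    rw [key' α₁ h₁ α₂ h₂, e1, e2]
  · intro h
    refine ⟨1, fun _ => 1, fun _ => Ω, fun _ => Ω, fun _ => zero_le_one, by simp,
      fun _ => hΩ.1, fun _ => hΩ.1, fun α₁ h₁ α₂ h₂ => ?_⟩
    simp [h α₁ h₁ α₂ h₂]
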